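/- For every n ≥ 2, N_3(S^{n-1}) = 2n. -/

import Mathlib

open MeasureTheory Metric Filter
open scoped ENNReal RealInnerProductSpace

noncomputable section

abbrev E (n : ℕ) : Type := EuclideanSpace ℝ (Fin n)

/-- The standard surface measure on the unit sphere `S^{n-1}`, as a Borel measure on `ℝⁿ`. -/
def sphMeasure (n : ℕ) : Measure (E n) :=
  Measure.map Subtype.val ((volume : Measure (E n)).toSphere)

/-- `P̊_m` : polynomials of degree at most `m` with zero mean on the sphere. -/
def P0 (n m : ℕ) : Set (MvPolynomial (Fin n) ℝ) :=
  {p | p.totalDegree ≤ m ∧ ∫ x, MvPolynomial.eval (fun i => x i) p ∂(sphMeasure n) = 0}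

/-- `N_m(S^{n-1})` : the smallest `N` for which there are `N` points on the sphere and
nonnegative weights summing to `1` whose weighted sums annihilate every `p ∈ P̊_m`. -/
def Nsph (n m : ℕ) : ℕ :=
  sInf {N : ℕ | ∃ (x : Fin N → E n) (w : Fin N → ℝ),
    (∀ i, x i ∈ Metric.sphere (0 : E n) 1) ∧ (∀ i, 0 ≤ w i) ∧ (∑ i, w i) = 1 ∧
    ∀ p ∈ P0 n m, (∑ i, w i * MvPolynomial.eval (fun j => x i j) p) = 0}

open scoped Pointwise in
theorem sph_apply (n : ℕ) {s : Set (E n)} (hs : MeasurableSet s) :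
    sphMeasure n s = n * volume (Set.Ioo (0 : ℝ) 1 • (s ∩ Metric.sphere (0 : E n) 1)) := by
  rw [sphMeasure, Measure.map_apply measurable_subtype_coe hs,
    Measure.toSphere_apply' _ (measurable_subtype_coe hs)]
  simp [Subtype.image_preimage_coe, Set.inter_comm]

open scoped Pointwise in
theorem sph_map (n : ℕ) (U : E n ≃ₗᵢ[ℝ] E n) : (sphMeasure n).map U = sphMeasure n := by
  ext s hs
  have hU : Measurable U := U.continuous.measurable
  rw [Measure.map_apply hU hs, sph_apply n (hU hs), sph_apply n hs]
  have h : Set.Ioo (0 : ℝ) 1 • ((U ⁻¹' s) ∩ Metric.sphere (0 : E n) 1)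
      = U.toMeasurableEquiv ⁻¹' (Set.Ioo (0 : ℝ) 1 • (s ∩ Metric.sphere (0 : E n) 1)) := by
    ext x
    simp only [Set.mem_smul, Set.mem_preimage, Set.mem_inter_iff, mem_sphere_zero_iff_norm]
    constructor
    · rintro ⟨a, ha, y, ⟨hy, hy'⟩, rfl⟩
      exact ⟨a, ha, U y, ⟨hy, by simpa using hy'⟩, by simp⟩
    · rintro ⟨a, ha, y, ⟨hy, hy'⟩, hx⟩
      refine ⟨a, ha, U.symm y, ⟨by simpa using hy, by simpa using hy'⟩, ?_⟩
      apply U.injective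
      simpa using hx
  rw [h]
  congr 1
  have hp : MeasurePreserving U.toMeasurableEquiv := U.measurePreserving
  exact hp.measure_preimage_equiv _

theorem sph_integral_comp (n : ℕ) (U : E n ≃ₗᵢ[ℝ] E n) (f : E n → ℝ) :
    ∫ x, f (U x) ∂(sphMeasure n) = ∫ x, f x ∂(sphMeasure n) := by
  conv_rhs => rw [← sph_map n U]
  exact (integral_map_equiv U.toMeasurableEquiv f).symm

instance sph_finite (n : ℕ) : IsFiniteMeasure (sphMeasure n) := by
  unfold sphMeasure; infer_instance

theorem sph_ae (n : ℕ) : ∀ᵐ x ∂(sphMeasure n), ‖x‖ = 1 := by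
  rw [sphMeasure, ae_map_iff measurable_subtype_coe.aemeasurable
    (measurableSet_eq_fun measurable_norm measurable_const)]
  exact ae_of_all _ fun x => by simp

theorem sph_integrable (n : ℕ) {f : E n → ℝ} (hf : Continuous f) :
    Integrable f (sphMeasure n) := by
  rw [sphMeasure, (MeasurableEmbedding.subtype_coe isClosed_sphere.measurableSet).integrable_map_iff]
  have : CompactSpace (Metric.sphere (0 : E n) 1) := isCompact_iff_compactSpace.1 (isCompact_sphere _ _)
  exact (hf.comp continuous_subtype_val).integrable_of_hasCompactSupport
    (HasCompactSupport.of_compactSpace _)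

theorem sph_pos (n : ℕ) (hn : 2 ≤ n) : 0 < (sphMeasure n).real Set.univ := by
  have : Nonempty (Fin n) := ⟨⟨0, by omega⟩⟩
  have h : sphMeasure n ≠ 0 := by
    rw [sphMeasure, Ne, Measure.map_eq_zero_iff measurable_subtype_coe.aemeasurable]
    exact Measure.toSphere_ne_zero _
  have : NeZero (sphMeasure n) := ⟨h⟩
  simp [measureReal_def, ENNReal.toReal_pos_iff, pos_iff_ne_zero, h]

/-- Sign change of one coordinate. -/
def refl1 (n : ℕ) (k : Fin n) : E n ≃ₗᵢ[ℝ] E n :=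
  LinearIsometryEquiv.piLpCongrRight 2
    (fun i => if i = k then LinearIsometryEquiv.neg ℝ else LinearIsometryEquiv.refl ℝ ℝ)

theorem refl1_apply (n : ℕ) (k i : Fin n) (x : E n) :
    refl1 n k x i = (if i = k then -1 else 1) * x i := by
  simp only [refl1, LinearIsometryEquiv.piLpCongrRight_apply]
  split_ifs <;> simp

theorem int_sq_eq (n : ℕ) (i j : Fin n) :
    ∫ x : E n, x i ^ 2 ∂(sphMeasure n) = ∫ x : E n, x j ^ 2 ∂(sphMeasure n) := by
  rw [← sph_integral_comp n (LinearIsometryEquiv.piLpCongrLeft 2 ℝ ℝ (Equiv.swap i j))]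
  simp [LinearIsometryEquiv.piLpCongrLeft_apply, Equiv.piCongrLeft'_apply]

theorem int_sq (n : ℕ) (hn : 2 ≤ n) (j : Fin n) :
    ∫ x : E n, x j ^ 2 ∂(sphMeasure n) = (sphMeasure n).real Set.univ / n := by
  have h1 : ∫ x : E n, ∑ i, x i ^ 2 ∂(sphMeasure n) = (sphMeasure n).real Set.univ := by
    have : (fun x : E n => ∑ i, x i ^ 2) =ᵐ[sphMeasure n] fun _ => 1 := by
      filter_upwards [sph_ae n] with x hx
      rw [← EuclideanSpace.real_norm_sq_eq, hx, one_pow]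
    rw [integral_congr_ae this]
    simp
  rw [integral_finsetSum _ (fun i _ => sph_integrable n (by fun_prop)),
    Finset.sum_congr rfl (fun i _ => int_sq_eq n i j)] at h1
  have : (n : ℝ) ≠ 0 := by positivity
  rw [← h1]
  field_simp
  simp [mul_comm]

theorem mono_single (n : ℕ) (d : Fin n →₀ ℕ) (j : Fin n) (s : ℝ) :
    ∏ i, (Pi.single j s : Fin n → ℝ) i ^ d i
      = s ^ d j * ∏ i ∈ Finset.univ.erase j, (0 : ℝ) ^ d i := by
  rw [← Finset.mul_prod_erase _ _ (Finset.mem_univ j)]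
  simp only [Pi.single_eq_same]
  congr 1
  refine Finset.prod_congr rfl fun i hi => ?_
  rw [Pi.single_eq_of_ne (Finset.ne_of_mem_erase hi)]

theorem quad_mono (n : ℕ) (hn : 2 ≤ n) (d : Fin n →₀ ℕ) (hd : ∑ i, d i ≤ 3) :
    ∫ x : E n, ∏ i, x i ^ d i ∂(sphMeasure n) = (sphMeasure n).real Set.univ / (2 * n) *
      ∑ j, (∏ i, (Pi.single j 1 : Fin n → ℝ) i ^ d i
        + ∏ i, (Pi.single j (-1) : Fin n → ℝ) i ^ d i) := by
  have hn0 : (n : ℝ) ≠ 0 := by positivity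
  by_cases hodd : ∃ k, Odd (d k)
  · obtain ⟨k, hk⟩ := hodd
    have h1 : ∫ x : E n, ∏ i, x i ^ d i ∂(sphMeasure n) = 0 := by
      have h := sph_integral_comp n (refl1 n k) (fun x => ∏ i, x i ^ d i)
      have h2 : ∀ x : E n, ∏ i, (refl1 n k x) i ^ d i = - ∏ i, x i ^ d i := by
        intro x
        simp only [refl1_apply, mul_pow, Finset.prod_mul_distrib, ite_pow, one_pow]
        simp [hk.neg_one_pow]
      simp only [h2, integral_neg] at h
      linarith
    rw [h1, Finset.sum_eq_zero, mul_zero]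
    intro j _
    rw [mono_single, mono_single]
    by_cases hjk : j = k
    · subst hjk
      simp [hk.neg_one_pow]
    · have : ∏ i ∈ Finset.univ.erase j, (0 : ℝ) ^ d i = 0 :=
        Finset.prod_eq_zero (i := k) (by simp [Ne.symm hjk]) (zero_pow hk.pos.ne')
      simp [this]
  · push Not at hodd
    by_cases h0 : d = 0
    · subst h0
      simp
      field_simp
      norm_num
    · obtain ⟨j, hj⟩ : ∃ j, d j ≠ 0 := by
        by_contra! h
        exact h0 (Finsupp.ext h)
      have hother : ∀ i, i ≠ j → d i = 0 := by
        intro i hi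
        have h1 : d i + d j ≤ ∑ i, d i := by
          rw [← Finset.sum_pair hi]
          exact Finset.sum_le_sum_of_subset (Finset.subset_univ _)
        have h2 := hodd i
        have h3 := hodd j
        rw [Nat.not_odd_iff_even] at h2 h3
        obtain ⟨a, ha⟩ := h2
        obtain ⟨b, hb⟩ := h3
        omega
      have hjj : d j = 2 := by
        have h1 : d j ≤ ∑ i, d i := Finset.single_le_sum (fun _ _ => Nat.zero_le _) (Finset.mem_univ j)
        have h3 := hodd j
        rw [Nat.not_odd_iff_even] at h3
        obtain ⟨b, hb⟩ := h3
        omega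
      have hf : ∀ y : Fin n → ℝ, ∏ i, y i ^ d i = y j ^ 2 := by
        intro y
        rw [Finset.prod_eq_single j (fun i _ hi => by simp [hother i hi]) (by simp), hjj]
      simp only [hf]
      rw [int_sq n hn, Finset.sum_eq_single j]
      · simp
        field_simp
        norm_num
      · intro i _ hi
        simp [Pi.single_eq_of_ne hi.symm]
      · simp

theorem quad (n : ℕ) (hn : 2 ≤ n) (p : MvPolynomial (Fin n) ℝ) (hp : p.totalDegree ≤ 3) :
    ∫ x : E n, MvPolynomial.eval (fun i => x i) p ∂(sphMeasure n) =
      (sphMeasure n).real Set.univ / (2 * n) *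
      ∑ j, (MvPolynomial.eval (Pi.single j 1) p + MvPolynomial.eval (Pi.single j (-1)) p) := by
  simp only [MvPolynomial.eval_eq']
  rw [integral_finsetSum _ (fun i _ => sph_integrable n (by fun_prop))]
  simp only [← Finset.sum_add_distrib, ← mul_add]
  rw [Finset.sum_comm, Finset.mul_sum]
  refine Finset.sum_congr rfl fun d hd => ?_
  rw [integral_const_mul, quad_mono n hn d, ← Finset.mul_sum]
  · ring
  · have := MvPolynomial.le_totalDegree hd
    rw [Finsupp.sum_fintype _ _ (by simp)] at this
    omega

theorem upper (n : ℕ) (hn : 2 ≤ n) : ∃ (x : Fin (2 * n) → E n) (w : Fin (2 * n) → ℝ),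
    (∀ i, x i ∈ Metric.sphere (0 : E n) 1) ∧ (∀ i, 0 ≤ w i) ∧ (∑ i, w i) = 1 ∧
    ∀ p ∈ P0 n 3, (∑ i, w i * MvPolynomial.eval (fun j => x i j) p) = 0 := by
  have hn0 : (n : ℝ) ≠ 0 := by positivity
  let e : Fin (2 * n) ≃ Fin n × Bool := Fintype.equivOfCardEq (by simp [mul_comm])
  refine ⟨fun k => EuclideanSpace.single (e k).1 (if (e k).2 then 1 else -1),
    fun _ => 1 / (2 * n), ?_, ?_, ?_, ?_⟩
  · intro k
    rw [mem_sphere_zero_iff_norm, EuclideanSpace.norm_single]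
    split_ifs <;> simp
  · intro _; positivity
  · simp
    field_simp
  · rintro p ⟨hp, hp0⟩
    rw [quad n hn p hp] at hp0
    have hc := sph_pos n hn
    have hs := (mul_eq_zero.1 hp0).resolve_left (by positivity)
    rw [← Finset.mul_sum]
    have h := e.sum_comp (fun q => MvPolynomial.eval
      (Pi.single q.1 (if q.2 then 1 else -1) : Fin n → ℝ) p)
    rw [Fintype.sum_prod_type] at h
    simp only [Fintype.sum_bool] at h
    simp only [if_true, Bool.false_eq_true, if_false] at h
    rw [hs] at h
    rw [mul_eq_zero]
    right
    exact h

theorem lower (n : ℕ) (hn : 2 ≤ n) (N : ℕ) (x : Fin N → E n) (w : Fin N → ℝ)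
    (hx : ∀ i, x i ∈ Metric.sphere (0 : E n) 1) (hw : ∀ i, 0 ≤ w i) (hw1 : (∑ i, w i) = 1)
    (h : ∀ p ∈ P0 n 3, (∑ i, w i * MvPolynomial.eval (fun j => x i j) p) = 0) :
    2 * n ≤ N := by
  have hn0 : (0 : ℝ) < n := by positivity
  have hx' : ∀ i, ‖x i‖ = 1 := fun i => by simpa using hx i
  have key : ∀ j, w j ≤ 1 / (2 * n) := by
    intro j
    let l : MvPolynomial (Fin n) ℝ := ∑ k, MvPolynomial.C (x j k) * MvPolynomial.X k
    have hl : l.totalDegree ≤ 1 := by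
      refine MvPolynomial.totalDegree_finsetSum_le fun k _ => ?_
      refine (MvPolynomial.totalDegree_mul _ _).trans ?_
      simp
    have hle : ∀ y : Fin n → ℝ, MvPolynomial.eval y l = ∑ k, x j k * y k := by
      intro y; simp [l]
    let p : MvPolynomial (Fin n) ℝ := l ^ 2 + l ^ 3 - MvPolynomial.C (1 / (n : ℝ))
    have hpe : ∀ y : Fin n → ℝ, MvPolynomial.eval y p
        = (∑ k, x j k * y k) ^ 2 + (∑ k, x j k * y k) ^ 3 - 1 / n := by
      intro y; simp [p, hle]
    have hpd : p.totalDegree ≤ 3 := by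
      refine (MvPolynomial.totalDegree_sub _ _).trans ?_
      refine max_le ((MvPolynomial.totalDegree_add _ _).trans (max_le ?_ ?_)) (by simp)
      · exact (MvPolynomial.totalDegree_pow _ _).trans (by omega)
      · exact (MvPolynomial.totalDegree_pow _ _).trans (by omega)
    have hnorm : ∑ k, x j k ^ 2 = 1 := by
      rw [← EuclideanSpace.real_norm_sq_eq, hx', one_pow]
    have hp0 : p ∈ P0 n 3 := by
      refine ⟨hpd, ?_⟩
      rw [quad n hn p hpd]
      have : ∀ i : Fin n, MvPolynomial.eval (Pi.single i 1) p + MvPolynomial.eval (Pi.single i (-1)) p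
          = 2 * x j i ^ 2 - 2 / n := by
        intro i
        rw [hpe, hpe]
        simp [Pi.single_apply]
        ring
      simp only [this, Finset.sum_sub_distrib, ← Finset.mul_sum, hnorm]
      simp
      right
      field_simp
      ring
    have hsum := h p hp0
    simp only [hpe, mul_sub, Finset.sum_sub_distrib, ← Finset.sum_mul, hw1] at hsum
    have hin : ∀ i, ∑ k, x j k * x i k = (inner ℝ (x i) (x j)) := by
      intro i; simp [PiLp.inner_apply]
    simp only [hin] at hsum
    have hnn : ∀ i ∈ Finset.univ, 0 ≤ w i * ((inner ℝ (x i) (x j)) ^ 2 + (inner ℝ (x i) (x j)) ^ 3) := by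
      intro i _
      have h1 := abs_real_inner_le_norm (x i) (x j)
      rw [hx', hx', one_mul, abs_le] at h1
      refine mul_nonneg (hw i) ?_
      nlinarith [mul_nonneg (sq_nonneg (inner ℝ (x i) (x j))) (by linarith : 0 ≤ 1 + (inner ℝ (x i) (x j)))]
    have h2 := Finset.single_le_sum hnn (Finset.mem_univ j)
    rw [real_inner_self_eq_norm_sq, hx'] at h2
    have h3 : w j * 2 ≤ 1 / n := by
      norm_num at h2 hsum ⊢
      linarith
    rw [le_div_iff₀ (by positivity)]
    rw [le_div_iff₀ hn0] at h3
    linarith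
  have hs : (1 : ℝ) ≤ N * (1 / (2 * n)) := by
    refine hw1.symm.le.trans ?_
    calc ∑ i, w i ≤ ∑ _i : Fin N, (1 / (2 * (n : ℝ))) := Finset.sum_le_sum fun i _ => key i
      _ = _ := by simp
  rw [mul_one_div, le_div_iff₀ (by positivity), one_mul] at hs
  exact_mod_cast hs

theorem stmt14 (n : ℕ) (hn : 2 ≤ n) : Nsph n 3 = 2 * n := by
  unfold Nsph
  apply le_antisymm
  · exact Nat.sInf_le (upper n hn)
  · obtain ⟨x, w, hx, hw, hw1, h⟩ := Nat.sInf_mem (⟨2 * n, upper n hn⟩ :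
      {N : ℕ | ∃ (x : Fin N → E n) (w : Fin N → ℝ),
    (∀ i, x i ∈ Metric.sphere (0 : E n) 1) ∧ (∀ i, 0 ≤ w i) ∧ (∑ i, w i) = 1 ∧
    ∀ p ∈ P0 n 3, (∑ i, w i * MvPolynomial.eval (fun j => x i j) p) = 0}.Nonempty)
    exact lower n hn _ x w hx hw hw1 h
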